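/- Let M, k ∈ ℕ with M ≥ 2, k ≥ 1, let A ⊆ {0,…,M−1} be nonempty, and let α ∈ ℚ with 1 ≤ α < M. Then S_k ≤ G^k, where S_k = (|A|/M)^k · sup_{x∈ℝ} Σ_{j∈C_k} |F_k(x + α·M^{−k}·j)|, F_k(x) = |A|^{−k} Σ_{l∈C_k} e^{−2πi·l·x}, and G = (|A|/M)·sup_{x∈ℝ} Σ_{a∈A} sup{ |F_1(t)| : t ∈ x + α·a/M + [0, α·(max A + 1)/M²] }. -/

import Mathlib

open scoped Classical

noncomputable section

/-- `e^{-2πi x}` -/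
def ec (x : ℝ) : ℂ := Complex.exp (-(2 * Real.pi * x) * Complex.I)

/-- The discrete Fourier transform matrix `F_N`, with entries `N^{-1/2} e^{-2πi jl/N}`. -/
def dftMatrix (N : ℕ) : Matrix (Fin N) (Fin N) ℂ :=
  Matrix.of fun j l : Fin N => ((Real.sqrt N)⁻¹ : ℝ) * ec ((j : ℕ) * (l : ℕ) / (N : ℝ))

/-- Multiplication by the indicator function of `S`, as a matrix on `ℂ^N`. -/
def indicatorMatrix (N : ℕ) (S : Finset ℕ) : Matrix (Fin N) (Fin N) ℂ :=
  Matrix.diagonal fun j => if (j : ℕ) ∈ S then 1 else 0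

/-- The discrete Cantor set `C_k = {a₀ + a₁ M + ⋯ + a_{k-1} M^{k-1} : a_j ∈ A}`. -/
def cantorC (M k : ℕ) (A : Finset ℕ) : Finset ℕ :=
  (Fintype.piFinset fun _ : Fin k => A).image fun a => ∑ j : Fin k, a j * M ^ (j : ℕ)

/-- The operator norm of a matrix acting on `ℂ^N` with the ℓ² norm. -/
def opNorm {N : ℕ} (A : Matrix (Fin N) (Fin N) ℂ) : ℝ :=
  ‖Matrix.toEuclideanCLM (𝕜 := ℂ) A‖

/-- The normalized exponential sum `F_1(x) = |A|⁻¹ Σ_{a ∈ A} e^{-2πi a x}`. -/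
def F1 (A : Finset ℕ) (x : ℝ) : ℂ := (A.card : ℂ)⁻¹ * ∑ a ∈ A, ec ((a : ℝ) * x)

/-- `G = (|A|/M) sup_{x ∈ ℝ} Σ_{a ∈ A} sup { |F_1(t)| : t ∈ x + αa/M + [0, α(max A + 1)/M²] }`. -/
def Gquant (M : ℕ) (A : Finset ℕ) (α : ℚ) : ℝ :=
  ((A.card : ℝ) / (M : ℝ)) *
    sSup (Set.range fun x : ℝ => ∑ a ∈ A,
      sSup ((fun t => ‖F1 A t‖) ''
        Set.Icc (x + (α : ℝ) * (a : ℝ) / (M : ℝ))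
          (x + (α : ℝ) * (a : ℝ) / (M : ℝ) + (α : ℝ) * ((A.sup id : ℕ) + 1) / (M : ℝ) ^ 2)))

/-- `F_k(x) = |A|^{-k} Σ_{l ∈ C_k} e^{-2πi l x}`. -/
def Fk (M k : ℕ) (A : Finset ℕ) (x : ℝ) : ℂ :=
  ((A.card : ℂ) ^ k)⁻¹ * ∑ l ∈ cantorC M k A, ec ((l : ℝ) * x)

/-- `S_k = (|A|/M)^k sup_{x ∈ ℝ} Σ_{j ∈ C_k} |F_k(x + α M^{-k} j)|`. -/
def Sk (M k : ℕ) (A : Finset ℕ) (α : ℚ) : ℝ :=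
  (((A.card : ℝ) / (M : ℝ)) ^ k) *
    sSup (Set.range fun x : ℝ =>
      ∑ j ∈ cantorC M k A, ‖Fk M k A (x + (α : ℝ) * ((M : ℝ) ^ k)⁻¹ * (j : ℝ))‖)

theorem ec_add' (x y : ℝ) : ec (x + y) = ec x * ec y := by
  unfold ec
  rw [← Complex.exp_add]
  congr 1
  push_cast
  ring

theorem norm_ec' (x : ℝ) : ‖ec x‖ = 1 := by
  unfold ec
  have : (-(2 * Real.pi * x) * Complex.I : ℂ) = ((-(2 * Real.pi * x) : ℝ) : ℂ) * Complex.I := by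
    push_cast; ring
  rw [this, Complex.norm_exp_ofReal_mul_I]

theorem norm_F1_le (A : Finset ℕ) (hA0 : A.Nonempty) (x : ℝ) : ‖F1 A x‖ ≤ 1 := by
  unfold F1
  have hc : (0 : ℝ) < A.card := by exact_mod_cast hA0.card_pos
  have h : ‖∑ a ∈ A, ec ((a : ℝ) * x)‖ ≤ A.card := by
    refine (norm_sum_le _ _).trans ?_
    simp [norm_ec']
  rw [norm_mul, norm_inv, Complex.norm_natCast, inv_mul_le_iff₀ hc]
  simpa using h

theorem mem_cantorC_succ (M k : ℕ) (A : Finset ℕ) :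
    cantorC M (k + 1) A = (cantorC M k A ×ˢ A).image fun p => p.2 + M * p.1 := by
  ext n
  simp only [cantorC, Finset.mem_image, Fintype.mem_piFinset, Finset.mem_product, Prod.exists]
  constructor
  · rintro ⟨a, ha, rfl⟩
    refine ⟨∑ j : Fin k, a j.succ * M ^ (j : ℕ), a 0, ⟨⟨fun j => a j.succ, fun j => ha _, rfl⟩, ha 0⟩, ?_⟩
    rw [Fin.sum_univ_succ, Finset.mul_sum]
    simp only [Fin.val_zero, pow_zero, mul_one, Fin.val_succ]
    congr 1
    refine Finset.sum_congr rfl fun j _ => ?_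
    ring
  · rintro ⟨j, a, ⟨⟨b, hb, rfl⟩, ha⟩, rfl⟩
    refine ⟨Fin.cons a b, fun i => ?_, ?_⟩
    · refine Fin.cases ?_ (fun i => ?_) i
      · simpa using ha
      · simpa using hb i
    · rw [Fin.sum_univ_succ, Finset.mul_sum]
      simp only [Fin.val_zero, pow_zero, mul_one, Fin.val_succ, Fin.cons_zero, Fin.cons_succ]
      congr 1
      refine Finset.sum_congr rfl fun j _ => ?_
      ring

theorem sum_cantorC_succ {E : Type*} [AddCommMonoid E] (M k : ℕ) (A : Finset ℕ) (hA : A ⊆ Finset.range M) (f : ℕ → E) :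
    ∑ j ∈ cantorC M (k + 1) A, f j = ∑ j ∈ cantorC M k A, ∑ a ∈ A, f (a + M * j) := by
  rw [mem_cantorC_succ, Finset.sum_image, Finset.sum_product]
  rintro ⟨j, a⟩ h ⟨j', a'⟩ h' e
  simp only [Finset.coe_product, Set.mem_prod, Finset.mem_coe] at h h'
  have h1 := Finset.mem_range.1 (hA h.2)
  have h2 := Finset.mem_range.1 (hA h'.2)
  have hM : 0 < M := by omega
  simp only at e h1 h2
  have e1 : a = a' := by
    have := congrArg (· % M) e
    simpa [Nat.add_mul_mod_self_left, Nat.mod_eq_of_lt h1, Nat.mod_eq_of_lt h2] using this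
  subst e1
  have e2 : j = j' := Nat.eq_of_mul_eq_mul_left hM (by omega)
  rw [e2]

theorem cantorC_zero (M : ℕ) (A : Finset ℕ) : cantorC M 0 A = {0} := by
  ext n
  simp [cantorC, eq_comm]

theorem Fk_succ (M k : ℕ) (A : Finset ℕ) (hA : A ⊆ Finset.range M) (x : ℝ) :
    Fk M (k + 1) A x = F1 A x * Fk M k A (M * x) := by
  unfold Fk F1
  rw [sum_cantorC_succ M k A hA]
  have : ∀ j ∈ cantorC M k A, ∑ a ∈ A, ec (((a + M * j : ℕ) : ℝ) * x)
      = (∑ a ∈ A, ec ((a : ℝ) * x)) * ec ((j : ℝ) * (M * x)) := by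
    intro j _
    rw [Finset.sum_mul]
    refine Finset.sum_congr rfl fun a _ => ?_
    rw [← ec_add']
    congr 1
    push_cast
    ring
  rw [Finset.sum_congr rfl this, ← Finset.mul_sum, pow_succ, mul_inv]
  ring

theorem norm_Fk (M k : ℕ) (A : Finset ℕ) (hA : A ⊆ Finset.range M) (x : ℝ) :
    ‖Fk M k A x‖ = ∏ m ∈ Finset.range k, ‖F1 A ((M : ℝ) ^ m * x)‖ := by
  induction k generalizing x with
  | zero => simp [Fk, cantorC_zero, norm_ec']
  | succ k ih =>
    rw [Fk_succ M k A hA, norm_mul, ih, Finset.prod_range_succ', mul_comm]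
    congr 1
    · refine Finset.prod_congr rfl fun m _ => ?_
      rw [pow_succ, mul_assoc]
    · simp

theorem cantorC_mod_lt (M k : ℕ) (A : Finset ℕ) (hA : A ⊆ Finset.range M) (hM : 0 < M)
    (j : ℕ) (hj : j ∈ cantorC M k A) (i : ℕ) :
    j % M ^ (i + 1) < (A.sup id + 1) * M ^ i := by
  induction k generalizing j i with
  | zero =>
    rw [cantorC_zero, Finset.mem_singleton] at hj
    subst hj
    simp only [Nat.zero_mod]
    positivity
  | succ k ih =>
    rw [mem_cantorC_succ, Finset.mem_image] at hj
    obtain ⟨⟨j', a⟩, hp, rfl⟩ := hj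
    rw [Finset.mem_product] at hp
    obtain ⟨hj', ha⟩ := hp
    simp only at hj' ha ⊢
    have haM := Finset.mem_range.1 (hA ha)
    have has : a ≤ A.sup id := Finset.le_sup (f := id) ha
    cases i with
    | zero =>
      simp only [zero_add, pow_one, pow_zero, mul_one, Nat.add_mul_mod_self_left,
        Nat.mod_eq_of_lt haM]
      omega
    | succ i =>
      have h := ih j' hj' i
      rw [pow_succ' M (i + 1), Nat.mod_mul, Nat.add_mul_mod_self_left, Nat.mod_eq_of_lt haM,
        Nat.add_mul_div_left _ _ hM, Nat.div_eq_of_lt haM, zero_add]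
      calc a + M * (j' % M ^ (i + 1)) < M * (j' % M ^ (i + 1) + 1) := by
            rw [mul_add]; omega
        _ ≤ M * ((A.sup id + 1) * M ^ i) := Nat.mul_le_mul_left _ h
        _ = _ := by ring

theorem cantor_sum_le (M : ℕ) (A : Finset ℕ) (hA : A ⊆ Finset.range M) (hM : 0 < M)
    (H : ℝ → ℝ) (hH : ∀ t, 0 ≤ H t) (α G : ℝ) 
    (hG : ∀ x, ∑ a ∈ A, H (x + α * a / M) ≤ G) (hG0 : 0 ≤ G) (k : ℕ) (y : ℕ → ℝ) :
    ∑ j ∈ cantorC M k A, ∏ i ∈ Finset.range k, H (y i + α * ((j / M ^ i : ℕ) : ℝ) / M) ≤ G ^ k := by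
  induction k generalizing y with
  | zero => simp [cantorC_zero]
  | succ k ih =>
    rw [sum_cantorC_succ M k A hA, pow_succ]
    refine le_trans ?_ (mul_le_mul_of_nonneg_right (ih fun i => y (i + 1)) hG0)
    rw [Finset.sum_mul]
    refine Finset.sum_le_sum fun j _ => ?_
    have hM' : (M : ℝ) ≠ 0 := by positivity
    have : ∀ a ∈ A, ∏ i ∈ Finset.range (k + 1),
        H (y i + α * (((a + M * j) / M ^ i : ℕ) : ℝ) / M)
        = (∏ i ∈ Finset.range k, H (y (i + 1) + α * ((j / M ^ i : ℕ) : ℝ) / M)) *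
          H ((y 0 + α * j) + α * a / M) := by
      intro a ha
      have haM := Finset.mem_range.1 (hA ha)
      rw [Finset.prod_range_succ']
      congr 1
      · refine Finset.prod_congr rfl fun i _ => ?_
        rw [pow_succ' M i, ← Nat.div_div_eq_div_mul, Nat.add_mul_div_left _ _ hM,
          Nat.div_eq_of_lt haM, zero_add]
      · congr 1
        simp only [pow_zero, Nat.div_one]
        push_cast
        field_simp
        ring
    rw [Finset.sum_congr rfl this, ← Finset.mul_sum]
    exact mul_le_mul_of_nonneg_left (hG _) (Finset.prod_nonneg fun i _ => hH _)

/-- `S_k ≤ G^k`. -/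
theorem stmt16 (M k : ℕ) (hM : 2 ≤ M) (hk : 1 ≤ k) (A : Finset ℕ) (hA : A ⊆ Finset.range M)
    (hA0 : A.Nonempty) (α : ℚ) (hα1 : 1 ≤ α) (hα2 : α < (M : ℚ)) :
    Sk M k A α ≤ Gquant M A α ^ k := by
  have hM0 : 0 < M := by omega
  have hMr : (0 : ℝ) < M := by exact_mod_cast hM0
  have hα : (0 : ℝ) ≤ (α : ℝ) := by
    have : (0 : ℚ) ≤ α := by linarith
    exact_mod_cast this
  unfold Sk Gquant
  rw [mul_pow]
  refine mul_le_mul_of_nonneg_left ?_ (by positivity)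
  set δ : ℝ := (α : ℝ) * ((A.sup id : ℕ) + 1) / (M : ℝ) ^ 2 with hδ
  have hδ0 : 0 ≤ δ := by positivity
  set H : ℝ → ℝ := fun t => sSup ((fun t => ‖F1 A t‖) '' Set.Icc t (t + δ)) with hHdef
  have hbdd : ∀ t, BddAbove ((fun t => ‖F1 A t‖) '' Set.Icc t (t + δ)) := by
    intro t
    refine ⟨1, ?_⟩
    rintro _ ⟨s, _, rfl⟩
    exact norm_F1_le A hA0 s
  have hH : ∀ t s, t ≤ s → s ≤ t + δ → ‖F1 A s‖ ≤ H t := fun t s h1 h2 =>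
    le_csSup (hbdd t) ⟨s, ⟨h1, h2⟩, rfl⟩
  have hH0 : ∀ t, 0 ≤ H t := fun t =>
    (norm_nonneg _).trans (hH t t le_rfl (by linarith))
  have hH1 : ∀ t, H t ≤ 1 := by
    intro t
    refine csSup_le ⟨_, t, ⟨le_rfl, by linarith⟩, rfl⟩ ?_
    rintro _ ⟨s, _, rfl⟩
    exact norm_F1_le A hA0 s
  change _ ≤ (sSup (Set.range fun x : ℝ => ∑ a ∈ A, H (x + (α : ℝ) * (a : ℝ) / (M : ℝ)))) ^ k
  have hG : ∀ x : ℝ, ∑ a ∈ A, H (x + (α : ℝ) * (a : ℝ) / (M : ℝ)) ≤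
      sSup (Set.range fun x : ℝ => ∑ a ∈ A, H (x + (α : ℝ) * (a : ℝ) / (M : ℝ))) := by
    intro x
    refine le_csSup ⟨A.card, ?_⟩ ⟨x, rfl⟩
    rintro _ ⟨s, rfl⟩
    refine (Finset.sum_le_sum fun a _ => hH1 _).trans ?_
    simp
  have hG0 := (Finset.sum_nonneg fun a (_ : a ∈ A) => hH0 (0 + (α : ℝ) * (a : ℝ) / (M : ℝ))).trans (hG 0)
  refine csSup_le (Set.range_nonempty _) ?_
  rintro _ ⟨x, rfl⟩
  refine le_trans ?_ (cantor_sum_le M A hA hM0 H hH0 α _ hG hG0 k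
    fun i => (M : ℝ) ^ (k - 1 - i) * x)
  refine Finset.sum_le_sum fun j hj => ?_
  rw [norm_Fk M k A hA, ← Finset.prod_range_reflect]
  refine Finset.prod_le_prod (fun _ _ => norm_nonneg _) fun i hi => ?_
  have hik := Finset.mem_range.1 hi
  have hkey : (M : ℝ) ^ (k - 1 - i) * (x + (α : ℝ) * ((M : ℝ) ^ k)⁻¹ * (j : ℝ)) =
      (M : ℝ) ^ (k - 1 - i) * x + α * ((j : ℝ) / M ^ i) / M := by
    obtain ⟨d, rfl⟩ : ∃ d, k = d + i + 1 := ⟨k - 1 - i, by omega⟩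
    have : d + i + 1 - 1 - i = d := by omega
    rw [this]
    field_simp
    ring
  have hdm : (j : ℝ) / M ^ i = ((j / M ^ i : ℕ) : ℝ) + ((j % M ^ i : ℕ) : ℝ) / M ^ i := by
    have : ((M ^ i * (j / M ^ i) + j % M ^ i : ℕ) : ℝ) = j := by rw [Nat.div_add_mod]
    rw [← this]
    push_cast
    field_simp
  have hr : ((j % M ^ i : ℕ) : ℝ) / M ^ i ≤ ((A.sup id : ℕ) + 1) / M := by
    cases i with
    | zero =>
      simp only [pow_zero, Nat.mod_one]
      simp only [Nat.cast_zero, zero_div]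
      positivity
    | succ i =>
      have := cantorC_mod_lt M k A hA hM0 j hj i
      have h2 : ((j % M ^ (i + 1) : ℕ) : ℝ) ≤ ((A.sup id : ℕ) + 1) * (M : ℝ) ^ i := by
        exact_mod_cast this.le
      rw [div_le_div_iff₀ (by positivity) hMr, pow_succ (M : ℝ) i, ← mul_assoc]
      exact mul_le_mul_of_nonneg_right h2 hMr.le
  have hr0 : 0 ≤ ((j % M ^ i : ℕ) : ℝ) / M ^ i := by positivity
  rw [hkey]
  apply hH
  · rw [hdm]
    gcongr
    linarith
  · have : δ = α * (((A.sup id : ℕ) + 1) / M) / M := by rw [hδ]; field_simp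
    rw [this, hdm, add_assoc, ← add_div, ← mul_add]
    gcongr

end
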